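/- Let D be an H-colored 3-quasi-transitive digraph. For every k ≥ 5, D has a (k,H)-kernel. -/

import Mathlib

/-!
Setting: `A : V → V → Prop` is the arc relation of a loopless digraph `D`,
`AH : VH → VH → Prop` is the arc relation of a digraph `H` (possibly with loops),
and `ρ : V → V → VH` colors each arc of `D` with a vertex of `H`
(`D` is an `H`-colored digraph).
-/

open scoped Classical

noncomputable section

variable {V VH : Type*}

/-- `x 0, x 1, …, x n` is a walk of length `n` in the digraph with arc relation `A`. -/
def IsWalk (A : V → V → Prop) (n : ℕ) (x : ℕ → V) : Prop :=
  ∀ i < n, A (x i) (x (i + 1))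

/-- A (directed) path of length `n`: a walk whose `n + 1` vertices are pairwise distinct. -/
def IsPath (A : V → V → Prop) (n : ℕ) (x : ℕ → V) : Prop :=
  IsWalk A n x ∧ ∀ i ≤ n, ∀ j ≤ n, x i = x j → i = j

/-- A (directed) cycle of length `n`: a nontrivial closed walk whose first `n` vertices are
pairwise distinct. -/
def IsCycle (A : V → V → Prop) (n : ℕ) (x : ℕ → V) : Prop :=
  IsWalk A n x ∧ x n = x 0 ∧ 1 ≤ n ∧ ∀ i < n, ∀ j < n, x i = x j → i = j

/-- The set `O_H(W)` of obstructions of an open walk `W = (x 0, …, x n)`: the indices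
`i ∈ {1, …, n-1}` such that `(ρ(x_{i-1}, x_i), ρ(x_i, x_{i+1}))` is not an arc of `H`. -/
def obstrOpen (AH : VH → VH → Prop) (ρ : V → V → VH) (n : ℕ) (x : ℕ → V) : Finset ℕ :=
  (Finset.Ico 1 n).filter fun i => ¬ AH (ρ (x (i - 1)) (x i)) (ρ (x i) (x (i + 1)))

/-- The set `O_H(W)` of obstructions of a closed walk `W = (x 0, …, x n)` (`x n = x 0`):
the indices `i ∈ {0, …, n-1}`, taken modulo `n`, such that
`(ρ(x_{i-1}, x_i), ρ(x_i, x_{i+1}))` is not an arc of `H`. -/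
def obstrClosed (AH : VH → VH → Prop) (ρ : V → V → VH) (n : ℕ) (x : ℕ → V) : Finset ℕ :=
  (Finset.range n).filter fun i =>
    ¬ AH (ρ (x (if i = 0 then n - 1 else i - 1)) (x i)) (ρ (x i) (x (i + 1)))

/-- The `H`-length of an open walk: `|O_H(W)| + 1`. -/
def HLenOpen (AH : VH → VH → Prop) (ρ : V → V → VH) (n : ℕ) (x : ℕ → V) : ℕ :=
  (obstrOpen AH ρ n x).card + 1

/-- The `H`-length of a closed walk: `|O_H(W)|`. -/
def HLenClosed (AH : VH → VH → Prop) (ρ : V → V → VH) (n : ℕ) (x : ℕ → V) : ℕ :=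
  (obstrClosed AH ρ n x).card

/-- `(u,v)` is an arc of the `(l,H)`-closure `C_H^l(D)` iff there exists a `uv`-path in `D`
with `H`-length at most `l`. -/
def ClosureAdj (A : V → V → Prop) (AH : VH → VH → Prop) (ρ : V → V → VH) (l : ℕ)
    (u v : V) : Prop :=
  ∃ n x, 1 ≤ n ∧ IsPath A n x ∧ x 0 = u ∧ x n = v ∧ HLenOpen AH ρ n x ≤ l

/-- `S` is `(k,H)`-independent: every path between two different vertices of `S`
has `H`-length at least `k`. -/
def KHIndependent (A : V → V → Prop) (AH : VH → VH → Prop) (ρ : V → V → VH)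
    (k : ℕ) (S : Set V) : Prop :=
  ∀ u ∈ S, ∀ v ∈ S, u ≠ v →
    ∀ n x, IsPath A n x → x 0 = u → x n = v → k ≤ HLenOpen AH ρ n x

/-- `S` is `(l,H)`-absorbent: from every vertex outside `S` there exists a path to some
vertex of `S` with `H`-length at most `l`. -/
def LHAbsorbent (A : V → V → Prop) (AH : VH → VH → Prop) (ρ : V → V → VH)
    (l : ℕ) (S : Set V) : Prop :=
  ∀ v ∉ S, ∃ w ∈ S, ∃ n x, IsPath A n x ∧ x 0 = v ∧ x n = w ∧ HLenOpen AH ρ n x ≤ l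

/-- A `(k,H)`-kernel: a `(k,H)`-independent and `(k-1,H)`-absorbent set of vertices. -/
def IsKHKernel (A : V → V → Prop) (AH : VH → VH → Prop) (ρ : V → V → VH)
    (k : ℕ) (S : Set V) : Prop :=
  KHIndependent A AH ρ k S ∧ LHAbsorbent A AH ρ (k - 1) S

/-- A kernel of a digraph: an independent and absorbent set of vertices. -/
def IsKernel (A : V → V → Prop) (S : Set V) : Prop :=
  (∀ u ∈ S, ∀ v ∈ S, u ≠ v → ¬ A u v) ∧ ∀ u ∉ S, ∃ v ∈ S, A u v

/-- A digraph is `3`-quasi-transitive if the endpoints of every path of length `3` are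
joined by an arc. -/
def ThreeQuasiTransitive (A : V → V → Prop) : Prop :=
  ∀ x : ℕ → V, IsPath A 3 x → A (x 0) (x 3) ∨ A (x 3) (x 0)

/-- There is a walk of length `n` from `u` to `v`. -/
def ReachesIn (A : V → V → Prop) : ℕ → V → V → Prop
  | 0, u, v => u = v
  | n + 1, u, v => ∃ w, A u w ∧ ReachesIn A n w v

/-- The distance from `u` to `v` is `n`. -/
def IsDist (A : V → V → Prop) (n : ℕ) (u v : V) : Prop :=
  ReachesIn A n u v ∧ ∀ m < n, ¬ ReachesIn A m u v

lemma reachesIn_one {A : V → V → Prop} {u v : V} : ReachesIn A 1 u v ↔ A u v := by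
  simp [ReachesIn]

lemma ReachesIn.append {A : V → V → Prop} {a b : ℕ} {u w v : V}
    (h : ReachesIn A a u w) (h' : ReachesIn A b w v) : ReachesIn A (a + b) u v := by
  induction a generalizing u with
  | zero =>
    cases h
    simpa using h'
  | succ a ih =>
    obtain ⟨t, hut, ht⟩ := h
    rw [Nat.succ_add]
    exact ⟨t, hut, ih ht⟩

lemma ReachesIn.split {A : V → V → Prop} {a b : ℕ} {u v : V}
    (h : ReachesIn A (a + b) u v) : ∃ w, ReachesIn A a u w ∧ ReachesIn A b w v := by
  induction a generalizing u with
  | zero => exact ⟨u, rfl, by simpa using h⟩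
  | succ a ih =>
    rw [Nat.succ_add] at h
    obtain ⟨t, hut, ht⟩ := h
    obtain ⟨w, htw, hwv⟩ := ih ht
    exact ⟨w, ⟨t, hut, htw⟩, hwv⟩

lemma IsWalk.reachesIn {A : V → V → Prop} {x : ℕ → V} {a b : ℕ}
    (h : IsWalk A (a + b) x) : ReachesIn A b (x a) (x (a + b)) := by
  induction b generalizing a with
  | zero => rfl
  | succ b ih =>
    refine ⟨x (a + 1), h a (by omega), ?_⟩
    have := ih (a := a + 1) (by rwa [Nat.add_right_comm])
    rwa [Nat.add_right_comm] at this

lemma ReachesIn.exists_isWalk {A : V → V → Prop} {n : ℕ} {u v : V}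
    (h : ReachesIn A n u v) : ∃ x, IsWalk A n x ∧ x 0 = u ∧ x n = v := by
  induction n generalizing u with
  | zero => exact ⟨fun _ => u, fun i hi => absurd hi (by omega), rfl, h⟩
  | succ n ih =>
    obtain ⟨w, huw, hw⟩ := h
    obtain ⟨x, hx, hx0, hxn⟩ := ih hw
    refine ⟨fun i => Nat.casesOn i u x, fun i hi => ?_, rfl, hxn⟩
    cases i with
    | zero => simpa [hx0] using huw
    | succ i => exact hx i (by omega)

lemma ReachesIn.exists_isDist {A : V → V → Prop} {n : ℕ} {u v : V}
    (h : ReachesIn A n u v) : ∃ m ≤ n, IsDist A m u v :=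
  have hex : ∃ m, ReachesIn A m u v := ⟨n, h⟩
  ⟨Nat.find hex, Nat.find_min' hex h, Nat.find_spec hex, fun _ hm => Nat.find_min hex hm⟩

lemma IsDist.split {A : V → V → Prop} {a b : ℕ} {u v : V} (h : IsDist A (a + b) u v) :
    ∃ w, IsDist A a u w ∧ IsDist A b w v := by
  obtain ⟨w, huw, hwv⟩ := h.1.split
  exact ⟨w, ⟨huw, fun m hm hr => h.2 _ (by omega) (hr.append hwv)⟩,
    ⟨hwv, fun m hm hr => h.2 _ (by omega) (huw.append hr)⟩⟩

lemma IsDist.ne {A : V → V → Prop} {n : ℕ} {u v : V} (h : IsDist A n u v) (hn : 0 < n) :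
    u ≠ v :=
  h.2 0 hn

lemma IsDist.exists_isPath {A : V → V → Prop} {n : ℕ} {u v : V} (h : IsDist A n u v) :
    ∃ x, IsPath A n x ∧ x 0 = u ∧ x n = v := by
  obtain ⟨x, hx, rfl, rfl⟩ := h.1.exists_isWalk
  have hlt : ∀ i j, i < j → j ≤ n → x i ≠ x j := by
    intro i j hij hj hxij
    have h₁ : ReachesIn A i (x 0) (x i) := by
      simpa using IsWalk.reachesIn (a := 0) (b := i) fun m hm => hx m (by omega)
    have h₂ : ReachesIn A (n - j) (x j) (x n) := by
      simpa [Nat.add_sub_cancel' hj] using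
        IsWalk.reachesIn (a := j) (b := n - j) fun m hm => hx m (by omega)
    exact h.2 _ (by omega) (h₁.append (hxij ▸ h₂))
  refine ⟨x, ⟨hx, fun i hi j hj hxij => ?_⟩, rfl, rfl⟩
  rcases lt_trichotomy i j with hij | hij | hij
  · exact absurd hxij (hlt i j hij hj)
  · exact hij
  · exact absurd hxij.symm (hlt j i hij hi)

lemma HLenOpen_le (AH : VH → VH → Prop) (ρ : V → V → VH) (n : ℕ) (x : ℕ → V) :
    HLenOpen AH ρ n x ≤ n - 1 + 1 := by
  have h := Finset.card_filter_le (Finset.Ico 1 n)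
    fun i => ¬ AH (ρ (x (i - 1)) (x i)) (ρ (x i) (x (i + 1)))
  rw [Nat.card_Ico] at h
  exact Nat.succ_le_succ h

lemma ReachesIn.closureAdj {A : V → V → Prop} {n l : ℕ} {u v : V} (h : ReachesIn A n u v)
    (hn : n ≤ l) (huv : u ≠ v) (AH : VH → VH → Prop) (ρ : V → V → VH) :
    ClosureAdj A AH ρ l u v := by
  obtain ⟨m, hm, hdist⟩ := h.exists_isDist
  obtain ⟨x, hx, hx0, hxm⟩ := hdist.exists_isPath
  have hm0 : 1 ≤ m := by
    by_contra hm0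
    obtain rfl : m = 0 := by omega
    exact huv hdist.1
  have := HLenOpen_le AH ρ m x
  exact ⟨m, x, hm0, hx, hx0, hxm, by omega⟩

lemma ClosureAdj.ne {A : V → V → Prop} {AH : VH → VH → Prop} {ρ : V → V → VH} {l : ℕ}
    {u v : V} (h : ClosureAdj A AH ρ l u v) : u ≠ v := by
  obtain ⟨n, x, hn, hx, rfl, rfl, -⟩ := h
  intro h0
  have := hx.2 0 (by omega) n le_rfl h0
  omega

lemma ClosureAdj.exists_reachesIn {A : V → V → Prop} {AH : VH → VH → Prop} {ρ : V → V → VH}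
    {l : ℕ} {u v : V} (h : ClosureAdj A AH ρ l u v) : ∃ n, ReachesIn A n u v := by
  obtain ⟨n, x, -, hx, rfl, rfl, -⟩ := h
  exact ⟨n, by simpa using IsWalk.reachesIn (a := 0) (b := n) (by simpa using hx.1)⟩

namespace ThreeQuasiTransitive

variable {A : V → V → Prop}

lemma adj_or_adj (h3qt : ThreeQuasiTransitive A) (hloopless : ∀ v, ¬ A v v) {a b c d : V}
    (hab : A a b) (hbc : A b c) (hcd : A c d) (hac : a ≠ c) (had : a ≠ d) (hbd : b ≠ d) :
    A a d ∨ A d a := by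
  have hne : ∀ {p q : V}, A p q → p ≠ q := fun hpq h => hloopless _ (h ▸ hpq)
  have := hne hab
  have := hne hbc
  have := hne hcd
  let x : ℕ → V := fun i => match i with
    | 0 => a
    | 1 => b
    | 2 => c
    | _ => d
  refine h3qt x ⟨fun i hi => ?_, fun i hi j hj hij => ?_⟩
  · interval_cases i <;> assumption
  · interval_cases i <;> interval_cases j <;> simp_all [x]

lemma adj_of_isDist_three (h3qt : ThreeQuasiTransitive A) (hloopless : ∀ v, ¬ A v v)
    {u v : V} (h : IsDist A 3 u v) : A v u := by
  obtain ⟨w, huw, hwv⟩ := h.split (a := 1) (b := 2)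
  obtain ⟨t, hwt, htv⟩ := hwv.split (a := 1) (b := 1)
  have hut : u ≠ t := by
    rintro rfl
    exact h.2 1 (by norm_num) htv.1
  exact (h3qt.adj_or_adj hloopless (reachesIn_one.1 huw.1) (reachesIn_one.1 hwt.1)
    (reachesIn_one.1 htv.1) hut (h.ne (by norm_num)) (hwv.ne (by norm_num))).resolve_left
    fun huv => h.2 1 (by norm_num) (reachesIn_one.2 huv)

lemma adj_of_isDist_odd (h3qt : ThreeQuasiTransitive A) (hloopless : ∀ v, ¬ A v v)
    {m : ℕ} {u v : V} (h : IsDist A (2 * m + 3) u v) : A v u := by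
  induction m generalizing u with
  | zero => exact h3qt.adj_of_isDist_three hloopless h
  | succ m ih =>
    obtain ⟨t, hut, htv⟩ := IsDist.split (a := 3) (b := 2 * m + 2)
      (by convert h using 1; omega)
    obtain ⟨w, huw, hwt⟩ := hut.split (a := 2) (b := 1)
    have hwv : IsDist A (2 * m + 3) w v := by
      refine ⟨?_, fun i hi hr => h.2 _ (by omega) (huw.1.append hr)⟩
      convert hwt.1.append htv.1 using 1
      omega
    exact (h3qt.adj_or_adj hloopless (ih hwv) (reachesIn_one.1 hwt.1)
      (h3qt.adj_of_isDist_three hloopless hut) (htv.ne (by omega)).symm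
      (h.ne (by omega)).symm (huw.ne (by omega)).symm).resolve_right
      fun huv => h.2 1 (by omega) (reachesIn_one.2 huv)

/-- Vertices at distance at least `3` can be reached back within `4` steps. -/
lemma reachesIn_of_isDist (h3qt : ThreeQuasiTransitive A) (hloopless : ∀ v, ¬ A v v)
    {n : ℕ} (hn : 3 ≤ n) {u v : V} (h : IsDist A n u v) : ∃ m ≤ 4, ReachesIn A m v u := by
  obtain ⟨m, rfl | rfl⟩ : ∃ m, n = 2 * m + 3 ∨ n = 1 + (2 * m + 3) :=
    ⟨(n - 3) / 2, by omega⟩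
  · exact ⟨1, by norm_num, reachesIn_one.2 (h3qt.adj_of_isDist_odd hloopless h)⟩
  · obtain ⟨w, huw, hwv⟩ := h.split
    obtain ⟨t, hwt, htv⟩ := IsDist.split (a := 2) (b := 2 * m + 1)
      (by convert hwv using 1; omega)
    have hut : IsDist A 3 u t :=
      ⟨huw.1.append hwt.1, fun i hi hr => h.2 _ (by omega) (hr.append htv.1)⟩
    have hvw := reachesIn_one.2 (h3qt.adj_of_isDist_odd hloopless hwv)
    have htu := reachesIn_one.2 (h3qt.adj_of_isDist_three hloopless hut)
    exact ⟨4, le_rfl, hvw.append (hwt.1.append htu)⟩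

/-- If `v` is within two steps of `u` but `u` is far from `v`, then everything within two steps
of `v` is within two steps of `u`. -/
lemma reachesIn_le_two (h3qt : ThreeQuasiTransitive A) (hloopless : ∀ v, ¬ A v v)
    {u v w : V} (huv : ∃ n ≤ 2, ReachesIn A n u v) (hvu : ∀ n ≤ 4, ¬ ReachesIn A n v u)
    (hvw : ∃ n ≤ 2, ReachesIn A n v w) : ∃ n ≤ 2, ReachesIn A n u w := by
  obtain ⟨i, hi, huv⟩ := huv
  obtain ⟨j, hj, hvw⟩ := hvw
  obtain ⟨n, hn, hdist⟩ := (huv.append hvw).exists_isDist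
  by_contra! hno
  have hn3 : 3 ≤ n := by
    by_contra hlt
    exact hno n (by omega) hdist.1
  obtain rfl | rfl : n = 3 ∨ n = 4 := by omega
  · exact hvu (j + 1) (by omega)
      (hvw.append (reachesIn_one.2 (h3qt.adj_of_isDist_three hloopless hdist)))
  · obtain ⟨rfl, rfl⟩ : i = 2 ∧ j = 2 := by omega
    obtain ⟨b, hvb, hbw⟩ := hvw.split (a := 1) (b := 1)
    have hub : IsDist A 3 u b :=
      ⟨huv.append hvb, fun m hm hr => hdist.2 _ (by omega) (hr.append hbw)⟩
    exact hvu 2 (by norm_num)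
      (hvb.append (reachesIn_one.2 (h3qt.adj_of_isDist_three hloopless hub)))

end ThreeQuasiTransitive

/-- If the asymmetric arcs of a digraph strictly decrease some rank, then every finite set of
vertices induces a subdigraph with a kernel. -/
lemma exists_kernel_of_rank (R : V → V → Prop) (f : V → ℕ)
    (hf : ∀ u v, R u v → ¬ R v u → f v < f u) (s : Finset V) :
    ∃ S : Finset V, S ⊆ s ∧ (∀ u ∈ S, ∀ v ∈ S, u ≠ v → ¬ R u v) ∧
      ∀ u ∈ s, u ∉ S → ∃ v ∈ S, R u v := by
  induction s using Finset.strongInduction with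
  | H s ih =>
    rcases s.eq_empty_or_nonempty with rfl | hs
    · exact ⟨∅, by simp⟩
    obtain ⟨v, hv, hmin⟩ := s.exists_min_image f hs
    obtain ⟨S, hSs, hind, habs⟩ := ih (s.filter fun u => u ≠ v ∧ ¬ R u v)
      (Finset.filter_ssubset.2 ⟨v, hv, by simp⟩)
    have hS : ∀ u ∈ S, u ∈ s ∧ u ≠ v ∧ ¬ R u v := fun u hu => Finset.mem_filter.1 (hSs hu)
    have hvS : ∀ u ∈ S, ¬ R v u := fun u hu hvu =>
      absurd (hf v u hvu (hS u hu).2.2) (hmin u (hS u hu).1).not_gt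
    refine ⟨insert v S, ?_, ?_, ?_⟩
    · exact Finset.insert_subset hv fun u hu => (hS u hu).1
    · intro a ha b hb hab
      rcases Finset.mem_insert.1 ha with rfl | haS <;>
        rcases Finset.mem_insert.1 hb with rfl | hbS
      · exact absurd rfl hab
      · exact hvS b hbS
      · exact (hS a haS).2.2
      · exact hind a haS b hbS hab
    · intro u hu huS
      rw [Finset.mem_insert, not_or] at huS
      by_cases huv : R u v
      · exact ⟨v, Finset.mem_insert_self _ _, huv⟩
      · obtain ⟨w, hw, huw⟩ := habs u (Finset.mem_filter.2 ⟨hu, huS.1, huv⟩) huS.2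
        exact ⟨w, Finset.mem_insert_of_mem hw, huw⟩

/-- Every `H`-colored `3`-quasi-transitive digraph has a `(k,H)`-kernel for every `k ≥ 5`. -/
theorem threeQuasiTransitive_has_kHKernel [Fintype V]
    (A : V → V → Prop) (hloopless : ∀ v : V, ¬ A v v)
    (h3qt : ThreeQuasiTransitive A)
    (AH : VH → VH → Prop) (ρ : V → V → VH)
    (k : ℕ) (hk : 5 ≤ k) :
    ∃ S : Set V, IsKHKernel A AH ρ k S := by
  let f : V → ℕ := fun u => {w | ∃ n ≤ 2, ReachesIn A n u w}.ncard
  have hf : ∀ u v, ClosureAdj A AH ρ (k - 1) u v → ¬ ClosureAdj A AH ρ (k - 1) v u →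
      f v < f u := by
    intro u v huv hvu
    have hfar : ∀ n ≤ 4, ¬ ReachesIn A n v u := fun n hn hr =>
      hvu (hr.closureAdj (by omega) huv.ne.symm AH ρ)
    obtain ⟨n, hn⟩ := huv.exists_reachesIn
    obtain ⟨m, -, hm⟩ := hn.exists_isDist
    have hm2 : m ≤ 2 := by
      by_contra hlt
      obtain ⟨i, hi, hr⟩ := h3qt.reachesIn_of_isDist hloopless (by omega) hm
      exact hfar i hi hr
    refine Set.ncard_lt_ncard (Set.ssubset_iff_of_subset ?_ |>.2 ⟨u, ?_, ?_⟩) (Set.toFinite _)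
    · exact fun w hw => h3qt.reachesIn_le_two hloopless ⟨m, hm2, hm.1⟩ hfar hw
    · exact ⟨0, by norm_num, rfl⟩
    · rintro ⟨i, hi, hr⟩
      exact hfar i (by omega) hr
  obtain ⟨S, -, hind, habs⟩ := exists_kernel_of_rank _ f hf Finset.univ
  refine ⟨S, fun u hu v hv huv n x hx hx0 hxn => ?_, fun v hv => ?_⟩
  · by_contra hlt
    have hn : 1 ≤ n := by
      by_contra hn
      obtain rfl : n = 0 := by omega
      exact huv (hx0.symm.trans hxn)
    exact hind u hu v hv huv ⟨n, x, hn, hx, hx0, hxn, by omega⟩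
  · obtain ⟨w, hw, n, x, -, hx⟩ := habs v (Finset.mem_univ v) hv
    exact ⟨w, hw, n, x, hx⟩
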